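/- Let H be a finitely generated free abelian group and V ⊆ H a primitive subgroup (i.e. the quotient H/V is torsion-free). Let H* = Hom_ℤ(H, ℤ), and let M^st = Λ*(H*) ⊗_ℤ ℤ[U, U⁻¹], on which each v ∈ H acts by the ℤ[U,U⁻¹]-linear endomorphism ι_v ⊗ id, where ι_v is the interior product on Λ*(H*) by the evaluation functional ⟨−, v⟩. Let Q^V(M^st) be the quotient of M^st by the additive subgroup generated by {(ι_v ⊗ id)(x) | v ∈ V, x ∈ M^st}; the action of each w ∈ H descends to Q^V(M^st). Then KQ^V(M^st) = {z ∈ Q^V(M^st) | w · z = 0 for all w ∈ H} is isomorphic, as a ℤ[U,U⁻¹]-module, to ℤ[U,U⁻¹] (i.e. it is free of rank one over the Laurent polynomial ring). -/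

import Mathlib

open TensorProduct

/-- The interior product (left contraction) on the exterior algebra `Λ*(H*)` over `ℤ`
by the evaluation functional `⟨−, v⟩ ∈ (H*)*` determined by `v ∈ H`. -/
noncomputable def dualContraction (H : Type*) [AddCommGroup H] [Module ℤ H] (v : H) :
    ExteriorAlgebra ℤ (Module.Dual ℤ H) →ₗ[ℤ] ExteriorAlgebra ℤ (Module.Dual ℤ H) :=
  CliffordAlgebra.contractLeft (Q := (0 : QuadraticForm ℤ (Module.Dual ℤ H)))
    (Module.Dual.eval ℤ H v)

/-- The standard module `M^st = Λ*(H*) ⊗_ℤ ℤ[U,U⁻¹]`, realized as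
`ℤ[U,U⁻¹] ⊗_ℤ Λ*(H*)` so that it carries its `ℤ[U,U⁻¹]`-module structure. -/
noncomputable abbrev Mst (H : Type*) [AddCommGroup H] [Module ℤ H] : Type _ :=
  LaurentPolynomial ℤ ⊗[ℤ] ExteriorAlgebra ℤ (Module.Dual ℤ H)

/-- The `ℤ[U,U⁻¹]`-linear action `ι_v ⊗ id` of `v ∈ H` on `M^st`. -/
noncomputable def MstAct (H : Type*) [AddCommGroup H] [Module ℤ H] (v : H) :
    Mst H →ₗ[LaurentPolynomial ℤ] Mst H :=
  LinearMap.baseChange (LaurentPolynomial ℤ) (dualContraction H v)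

/-- Two families of endomorphisms satisfying the canonical anticommutation relations:
annihilation operators `c i` and creation operators `a i`. -/
structure IsCanonicalAnticommuting {R M ι : Type*} [CommRing R] [AddCommGroup M] [Module R M]
    (c a : ι → Module.End R M) : Prop where
  c_c : ∀ i j x, c i (c j x) = -c j (c i x)
  c_c_self : ∀ i x, c i (c i x) = 0
  a_a : ∀ i j x, a i (a j x) = -a j (a i x)
  a_a_self : ∀ i x, a i (a i x) = 0
  c_a_self : ∀ i x, c i (a i x) = x - a i (c i x)
  c_a_of_ne : ∀ i j x, i ≠ j → c i (a j x) = -a j (c i x)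

namespace IsCanonicalAnticommuting

variable {R M ι : Type*} [CommRing R] [AddCommGroup M] [Module R M] {c a : ι → Module.End R M}

theorem prod_c_apply_c (h : IsCanonicalAnticommuting c a) (L : List ι) (j : ι) (x : M) :
    (L.map c).prod (c j x) = (-1 : R) ^ L.length • c j ((L.map c).prod x) := by
  induction L with
  | nil => simp
  | cons i L ih =>
    simp only [List.map_cons, List.prod_cons, Module.End.mul_apply, ih, map_smul,
      List.length_cons, pow_succ]
    rw [h.c_c i j]
    simp

theorem prod_c_apply_c_eq_zero_iff (h : IsCanonicalAnticommuting c a) (L : List ι) (j : ι)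
    (x : M) : (L.map c).prod (c j x) = 0 ↔ c j ((L.map c).prod x) = 0 := by
  rw [h.prod_c_apply_c]
  rcases neg_one_pow_eq_or R L.length with e | e <;> simp [e]

theorem c_prod_c_apply_of_mem (h : IsCanonicalAnticommuting c a) {L : List ι} {j : ι}
    (hj : j ∈ L) (x : M) : c j ((L.map c).prod x) = 0 := by
  induction L with
  | nil => simp at hj
  | cons i L ih =>
    simp only [List.map_cons, List.prod_cons, Module.End.mul_apply]
    rcases List.mem_cons.1 hj with rfl | hj
    · exact h.c_c_self _ _
    · rw [h.c_c, ih hj, map_zero, neg_zero]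

theorem mem_of_prod_c_eq_zero (h : IsCanonicalAnticommuting c a) (L : List ι) (hL : L.Nodup)
    (x : M) (hx : (L.map c).prod x = 0) : x ∈ ⨆ i ∈ L, LinearMap.range (c i) := by
  induction L generalizing x with
  | nil => simpa using hx
  | cons i L ih =>
    obtain ⟨hi, hL⟩ := List.nodup_cons.1 hL
    have hy : c i x ∈ ⨆ j ∈ L, LinearMap.range (c j) := by
      refine ih hL _ ((h.prod_c_apply_c_eq_zero_iff L i x).2 ?_)
      simpa using hx
    have key : (⨆ j ∈ L, LinearMap.range (c j)) ≤
        (⨆ j ∈ i :: L, LinearMap.range (c j)).comap (a i) := by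
      refine iSup₂_le fun j hj ↦ ?_
      rintro _ ⟨y, rfl⟩
      have hne : j ≠ i := fun e ↦ hi (e ▸ hj)
      rw [Submodule.mem_comap, ← neg_neg (a i (c j y)), ← h.c_a_of_ne j i y hne]
      exact Submodule.neg_mem _ (Submodule.mem_iSup_of_mem j
        (Submodule.mem_iSup_of_mem (List.mem_cons_of_mem _ hj) ⟨_, rfl⟩))
    have hx' : x = c i (a i x) + a i (c i x) := by rw [h.c_a_self, sub_add_cancel]
    rw [hx']
    exact Submodule.add_mem _ (Submodule.mem_iSup_of_mem i
      (Submodule.mem_iSup_of_mem List.mem_cons_self ⟨_, rfl⟩)) (key hy)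

theorem exists_prod_c_eq (h : IsCanonicalAnticommuting c a) (L : List ι) (hL : L.Nodup)
    (y : M) (hy : ∀ i ∈ L, c i y = 0) : ∃ x, (L.map c).prod x = y := by
  induction L generalizing y with
  | nil => exact ⟨y, by simp⟩
  | cons i L ih =>
    obtain ⟨hi, hL⟩ := List.nodup_cons.1 hL
    obtain ⟨x, hx⟩ := ih hL (a i y) fun j hj ↦ by
      have hne : j ≠ i := fun e ↦ hi (e ▸ hj)
      rw [h.c_a_of_ne j i y hne, hy j (List.mem_cons_of_mem _ hj), map_zero, neg_zero]
    refine ⟨x, ?_⟩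
    simp [hx, h.c_a_self, hy i List.mem_cons_self]

theorem sum_a_eq_zero_of_forall_c_eq_zero (h : IsCanonicalAnticommuting c a) (s : Finset ι)
    (y : ι → M) (hy : ∀ i ∈ s, c i (∑ j ∈ s, a j (y j)) = 0) : ∑ j ∈ s, a j (y j) = 0 := by
  classical
  induction s using Finset.induction_on generalizing y with
  | empty => simp
  | insert i s hi ih =>
    have key : ∑ j ∈ insert i s, a j (y j) = ∑ j ∈ s, a j (c i (a i (y j))) := by
      have h1 := h.c_a_self i (∑ j ∈ insert i s, a j (y j))
      rw [hy i (Finset.mem_insert_self _ _), map_zero, sub_zero] at h1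
      rw [← h1, Finset.sum_insert hi, map_add, h.a_a_self, zero_add, map_sum, map_sum]
      refine Finset.sum_congr rfl fun j hj ↦ ?_
      have hne : i ≠ j := fun e ↦ hi (e ▸ hj)
      rw [h.a_a, map_neg, h.c_a_of_ne i j _ hne, neg_neg]
    rw [key] at hy ⊢
    exact ih _ fun j hj ↦ hy j (Finset.mem_insert_of_mem hj)

end IsCanonicalAnticommuting

section StandardModule

variable {H : Type*} [AddCommGroup H] [Module ℤ H]

/-- Exterior multiplication by `φ ∈ H*` on `M^st`. -/
noncomputable def MstWedge (φ : Module.Dual ℤ H) : Mst H →ₗ[LaurentPolynomial ℤ] Mst H :=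
  LinearMap.baseChange (LaurentPolynomial ℤ) (LinearMap.mulLeft ℤ (ExteriorAlgebra.ι ℤ φ))

/-- The `ℤ[U,U⁻¹]`-linear projection of `M^st` onto its exterior degree zero part. -/
noncomputable def MstScalar (H : Type*) [AddCommGroup H] [Module ℤ H] :
    Mst H →ₗ[LaurentPolynomial ℤ] LaurentPolynomial ℤ :=
  (TensorProduct.AlgebraTensorModule.rid ℤ (LaurentPolynomial ℤ)
    (LaurentPolynomial ℤ)).toLinearMap ∘ₗ
    LinearMap.baseChange (LaurentPolynomial ℤ)
      (ExteriorAlgebra.algebraMapInv (R := ℤ) (M := Module.Dual ℤ H)).toLinearMap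

theorem MstScalar_tmul_one (r : LaurentPolynomial ℤ) : MstScalar H (r ⊗ₜ 1) = r := by
  simp [MstScalar]

theorem MstAct_tmul (v : H) (r : LaurentPolynomial ℤ)
    (x : ExteriorAlgebra ℤ (Module.Dual ℤ H)) :
    MstAct H v (r ⊗ₜ x) = r ⊗ₜ dualContraction H v x := rfl

theorem MstWedge_tmul (φ : Module.Dual ℤ H) (r : LaurentPolynomial ℤ)
    (x : ExteriorAlgebra ℤ (Module.Dual ℤ H)) :
    MstWedge φ (r ⊗ₜ x) = r ⊗ₜ (ExteriorAlgebra.ι ℤ φ * x) := rfl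

theorem dualContraction_ι_mul (v : H) (φ : Module.Dual ℤ H)
    (x : ExteriorAlgebra ℤ (Module.Dual ℤ H)) :
    dualContraction H v (ExteriorAlgebra.ι ℤ φ * x) =
      φ v • x - ExteriorAlgebra.ι ℤ φ * dualContraction H v x :=
  CliffordAlgebra.contractLeft_ι_mul _ _ _

theorem MstAct_tmul_one (v : H) (r : LaurentPolynomial ℤ) : MstAct H v (r ⊗ₜ 1) = 0 := by
  rw [MstAct_tmul, dualContraction, CliffordAlgebra.contractLeft_one, tmul_zero]

theorem MstAct_MstAct (v w : H) (x : Mst H) :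
    MstAct H v (MstAct H w x) = -MstAct H w (MstAct H v x) := by
  induction x using TensorProduct.induction_on with
  | zero => simp
  | add x y hx hy => simp only [map_add, hx, hy, neg_add]
  | tmul r x =>
    simp only [MstAct_tmul, dualContraction]
    rw [CliffordAlgebra.contractLeft_comm, tmul_neg]

theorem MstAct_MstAct_self (v : H) (x : Mst H) : MstAct H v (MstAct H v x) = 0 := by
  induction x using TensorProduct.induction_on with
  | zero => simp
  | add x y hx hy => simp only [map_add, hx, hy, add_zero]
  | tmul r x =>
    simp only [MstAct_tmul, dualContraction]
    rw [CliffordAlgebra.contractLeft_contractLeft, tmul_zero]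

theorem MstWedge_MstWedge_self (φ : Module.Dual ℤ H) (x : Mst H) :
    MstWedge φ (MstWedge φ x) = 0 := by
  induction x using TensorProduct.induction_on with
  | zero => simp
  | add x y hx hy => simp only [map_add, hx, hy, add_zero]
  | tmul r x =>
    rw [MstWedge_tmul, MstWedge_tmul, ← mul_assoc, ExteriorAlgebra.ι_sq_zero, zero_mul, tmul_zero]

theorem MstWedge_MstWedge (φ ψ : Module.Dual ℤ H) (x : Mst H) :
    MstWedge φ (MstWedge ψ x) = -MstWedge ψ (MstWedge φ x) := by
  induction x using TensorProduct.induction_on with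
  | zero => simp
  | add x y hx hy => simp only [map_add, hx, hy, neg_add]
  | tmul r x =>
    simp only [MstWedge_tmul]
    rw [← mul_assoc, ← mul_assoc, ← tmul_neg, ← neg_mul,
      eq_neg_of_add_eq_zero_left (ExteriorAlgebra.ι_add_mul_swap φ ψ)]

theorem MstAct_MstWedge (v : H) (φ : Module.Dual ℤ H) (x : Mst H) :
    MstAct H v (MstWedge φ x) = φ v • x - MstWedge φ (MstAct H v x) := by
  induction x using TensorProduct.induction_on with
  | zero => simp
  | add x y hx hy => simp only [map_add, hx, hy, smul_add]; abel
  | tmul r x =>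
    simp only [MstWedge_tmul, MstAct_tmul]
    rw [dualContraction_ι_mul, tmul_sub, tmul_smul]

/-- The action of `H` on `M^st`, evaluated at a fixed element, as a linear map in `v ∈ H`. -/
noncomputable def MstActAt (x : Mst H) : H →ₗ[ℤ] Mst H where
  toFun v := MstAct H v x
  map_add' v w := by simp [MstAct, dualContraction, LinearMap.baseChange_add]
  map_smul' n v := by
    simp only [MstAct, dualContraction, map_smul, LinearMap.baseChange_smul, LinearMap.smul_apply,
      RingHom.id_apply]

end StandardModule

theorem exists_basis_span_range_inl_eq {R H : Type*} [CommRing R] [IsDomain R]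
    [IsPrincipalIdealRing R] [AddCommGroup H] [Module R H] [Module.Free R H] [Module.Finite R H]
    (V : Submodule R H) [Module.IsTorsionFree R (H ⧸ V)] :
    ∃ (m n : ℕ) (b : Module.Basis (Fin m ⊕ Fin n) R H),
      V = Submodule.span R (Set.range fun i ↦ b (Sum.inl i)) := by
  obtain ⟨s, hs⟩ := Module.projective_lifting_property V.mkQ LinearMap.id V.mkQ_surjective
  have hs' : ∀ q, V.mkQ (s q) = q := LinearMap.congr_fun hs
  have hV : ∀ v : V, V.mkQ (v : H) = 0 := fun v ↦ by simp
  have he : Function.Bijective (V.subtype.coprod s) := by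
    refine ⟨(injective_iff_map_eq_zero _).2 ?_, fun x ↦ ?_⟩
    · rintro ⟨v, q⟩ h
      rw [LinearMap.coprod_apply, Submodule.subtype_apply] at h
      have hq : q = 0 := by simpa only [map_add, hV, hs', zero_add, map_zero] using congrArg V.mkQ h
      subst hq
      simpa using h
    · have hx : x - s (V.mkQ x) ∈ V := by
        rw [← Submodule.Quotient.mk_eq_zero, ← Submodule.mkQ_apply, map_sub, hs', sub_self]
      exact ⟨(⟨_, hx⟩, V.mkQ x), by simp⟩
  let e := LinearEquiv.ofBijective (V.subtype.coprod s) he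
  let bV := Module.finBasis R V
  let b := (bV.prod (Module.finBasis R (H ⧸ V))).map e
  have hb : ∀ i, b (Sum.inl i) = bV i := fun i ↦ by
    simp [b, e]
  refine ⟨_, _, b, ?_⟩
  have hr : (Set.range fun i ↦ b (Sum.inl i)) = V.subtype '' Set.range bV := by
    rw [← Set.range_comp]
    exact congrArg Set.range (funext hb)
  rw [hr, Submodule.span_image, bV.span_eq, Submodule.map_top, Submodule.range_subtype]

section Basis

variable {H : Type*} [AddCommGroup H] [Module ℤ H]

theorem isCanonicalAnticommuting_MstAct_MstWedge {κ : Type*} (b : Module.Basis κ ℤ H) :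
    IsCanonicalAnticommuting (fun i ↦ MstAct H (b i)) (fun i ↦ MstWedge (b.coord i)) where
  c_c _ _ := MstAct_MstAct _ _
  c_c_self _ := MstAct_MstAct_self _
  a_a _ _ := MstWedge_MstWedge _ _
  a_a_self _ := MstWedge_MstWedge_self _
  c_a_self i x := by simp [MstAct_MstWedge]
  c_a_of_ne i j x hij := by
    rw [MstAct_MstWedge, Module.Basis.coord_apply, Module.Basis.repr_self,
      Finsupp.single_eq_of_ne hij.symm, zero_smul, zero_sub]

theorem exists_eq_tmul_one_add_sum_MstWedge {κ : Type*} [Fintype κ] (b : Module.Basis κ ℤ H)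
    (x : Mst H) :
    ∃ (r : LaurentPolynomial ℤ) (y : κ → Mst H),
      x = r ⊗ₜ 1 + ∑ i, MstWedge (b.coord i) (y i) := by
  classical
  induction x using TensorProduct.induction_on with
  | zero => exact ⟨0, 0, by simp⟩
  | add x x' hx hx' =>
    obtain ⟨r, y, rfl⟩ := hx
    obtain ⟨r', y', rfl⟩ := hx'
    refine ⟨r + r', y + y', ?_⟩
    simp only [add_tmul, Pi.add_apply, map_add, Finset.sum_add_distrib]
    abel
  | tmul r x =>
    induction x using CliffordAlgebra.left_induction with
    | algebraMap m =>
      refine ⟨m • r, 0, ?_⟩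
      rw [Algebra.algebraMap_eq_smul_one, tmul_smul, smul_tmul']
      simp
    | add x x' hx hx' =>
      obtain ⟨s, y, hx⟩ := hx
      obtain ⟨s', y', hx'⟩ := hx'
      refine ⟨s + s', y + y', ?_⟩
      simp only [tmul_add, hx, hx', add_tmul, Pi.add_apply, map_add, Finset.sum_add_distrib]
      abel
    | ι_mul x φ _ =>
      refine ⟨0, fun i ↦ r ⊗ₜ (φ (b i) • x), ?_⟩
      have hφ : ExteriorAlgebra.ι ℤ φ = ∑ i, φ (b i) • ExteriorAlgebra.ι ℤ (b.coord i) := by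
        conv_lhs => rw [← b.sum_dual_apply_smul_coord φ]
        rw [map_sum]
        exact Finset.sum_congr rfl fun i _ ↦ map_smul _ _ _
      change r ⊗ₜ[ℤ] (ExteriorAlgebra.ι ℤ φ * x) = _
      rw [hφ, Finset.sum_mul, tmul_sum, zero_tmul, zero_add]
      refine Finset.sum_congr rfl fun i _ ↦ ?_
      rw [MstWedge_tmul, mul_smul_comm, smul_mul_assoc]

theorem exists_eq_tmul_one_of_forall_MstAct_eq_zero {κ : Type*} [Fintype κ]
    (b : Module.Basis κ ℤ H) (x : Mst H) (hx : ∀ i, MstAct H (b i) x = 0) :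
    ∃ r : LaurentPolynomial ℤ, x = r ⊗ₜ 1 := by
  obtain ⟨r, y, rfl⟩ := exists_eq_tmul_one_add_sum_MstWedge b x
  refine ⟨r, ?_⟩
  rw [(isCanonicalAnticommuting_MstAct_MstWedge b).sum_a_eq_zero_of_forall_c_eq_zero
    Finset.univ y fun i _ ↦ ?_, add_zero]
  simpa only [map_add, MstAct_tmul_one, zero_add] using hx i

end Basis

/-- Let `H` be a finitely generated free abelian group and `V ⊆ H` a
primitive subgroup (`H/V` torsion-free). Let `Q^V(M^st)` be the quotient of
`M^st = Λ*(H*) ⊗_ℤ ℤ[U,U⁻¹]` by the additive subgroup generated by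
`{(ι_v ⊗ id)(x) | v ∈ V, x ∈ M^st}`; the action of each `w ∈ H` descends to
`Q^V(M^st)`. Then `KQ^V(M^st) = {z ∈ Q^V(M^st) | w · z = 0 for all w ∈ H}` is
isomorphic, as a `ℤ[U,U⁻¹]`-module, to `ℤ[U,U⁻¹]`. -/
theorem KQ_of_standard_module_free_of_rank_one
    (H : Type*) [AddCommGroup H] [Module ℤ H] [Module.Free ℤ H] [Module.Finite ℤ H]
    (V : Submodule ℤ H) [NoZeroSMulDivisors ℤ (H ⧸ V)]
    (NV : Submodule (LaurentPolynomial ℤ) (Mst H))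
    (hNV : (NV : Set (Mst H)) =
      ↑(AddSubgroup.closure {z : Mst H | ∃ v ∈ V, ∃ x : Mst H, z = MstAct H v x}))
    (act' : H → (Mst H ⧸ NV) →ₗ[LaurentPolynomial ℤ] (Mst H ⧸ NV))
    (hact' : ∀ (w : H) (x : Mst H), act' w (NV.mkQ x) = NV.mkQ (MstAct H w x))
    (KQ : Submodule (LaurentPolynomial ℤ) (Mst H ⧸ NV))
    (hKQ : (KQ : Set (Mst H ⧸ NV)) = {z : Mst H ⧸ NV | ∀ w : H, act' w z = 0}) :
    Nonempty (KQ ≃ₗ[LaurentPolynomial ℤ] LaurentPolynomial ℤ) := by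
  have : @Module.IsTorsionFree ℤ (H ⧸ V) _ _ (Submodule.Quotient.module V) := by
    rw [Subsingleton.elim (Submodule.Quotient.module V) (AddCommGroup.toIntModule (H ⧸ V))]
    infer_instance
  obtain ⟨m, n, b, hb⟩ := exists_basis_span_range_inl_eq V
  have h := isCanonicalAnticommuting_MstAct_MstWedge b
  set c : Fin m ⊕ Fin n → Module.End (LaurentPolynomial ℤ) (Mst H) :=
    fun i ↦ MstAct H (b i)
  set L : List (Fin m ⊕ Fin n) := (List.finRange m).map Sum.inl with hL
  have hnodup : L.Nodup := (List.nodup_finRange m).map Sum.inl_injective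
  set ψ : Module.End (LaurentPolynomial ℤ) (Mst H) := (L.map c).prod
  have hbV : ∀ i, b (Sum.inl i) ∈ V := fun i ↦ by
    rw [hb]
    exact Submodule.subset_span ⟨i, rfl⟩
  have hker : NV = LinearMap.ker ψ := by
    apply le_antisymm
    · intro x hx
      rw [← SetLike.mem_coe, hNV, SetLike.mem_coe] at hx
      refine (AddSubgroup.closure_le (LinearMap.ker ψ).toAddSubgroup).2 ?_ hx
      rintro _ ⟨v, hv, x, rfl⟩
      have hle : V ≤ LinearMap.ker
          ((ψ.restrictScalars ℤ).comp (MstActAt x)) := by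
        rw [hb, Submodule.span_le]
        rintro _ ⟨i, rfl⟩
        have hi : Sum.inl i ∈ L := by simp [hL]
        exact (h.prod_c_apply_c_eq_zero_iff L _ x).2 (h.c_prod_c_apply_of_mem hi x)
      exact hle hv
    · intro x hx
      refine (iSup₂_le fun i hi ↦ ?_ : (⨆ i ∈ L, LinearMap.range (c i)) ≤ NV)
        (h.mem_of_prod_c_eq_zero L hnodup x hx)
      rintro _ ⟨y, rfl⟩
      obtain ⟨j, -, rfl⟩ := List.mem_map.1 hi
      rw [← SetLike.mem_coe, hNV]
      exact AddSubgroup.subset_closure ⟨_, hbV j, y, rfl⟩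
  have hmem : ∀ x, NV.mkQ x ∈ KQ ↔ ∃ r : LaurentPolynomial ℤ, ψ x = r ⊗ₜ 1 := by
    intro x
    rw [← SetLike.mem_coe, hKQ, Set.mem_ofPred_eq]
    have hz : ∀ w, act' w (NV.mkQ x) = 0 ↔ ψ (MstAct H w x) = 0 := fun w ↦ by
      rw [hact', Submodule.mkQ_apply, Submodule.Quotient.mk_eq_zero, hker, LinearMap.mem_ker]
    simp only [hz]
    constructor
    · intro hx
      exact exists_eq_tmul_one_of_forall_MstAct_eq_zero b _ fun i ↦
        (h.prod_c_apply_c_eq_zero_iff L i x).1 (hx (b i))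
    · rintro ⟨r, hr⟩ w
      have hle : (⊤ : Submodule ℤ H) ≤ LinearMap.ker
          ((ψ.restrictScalars ℤ).comp (MstActAt x)) := by
        rw [← b.span_eq, Submodule.span_le]
        rintro _ ⟨i, rfl⟩
        refine (h.prod_c_apply_c_eq_zero_iff L i x).2 ?_
        change c i (ψ x) = 0
        rw [hr]
        exact MstAct_tmul_one _ _
      exact hle (Submodule.mem_top (x := w))
  let θ : KQ →ₗ[LaurentPolynomial ℤ] LaurentPolynomial ℤ :=
    (NV.liftQ (MstScalar H ∘ₗ ψ) fun x hx ↦ by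
      rw [hker, LinearMap.mem_ker] at hx
      simp [hx]) ∘ₗ KQ.subtype
  have hθ : ∀ x hx, θ ⟨NV.mkQ x, hx⟩ = MstScalar H (ψ x) := fun x hx ↦ rfl
  refine ⟨LinearEquiv.ofBijective θ ⟨(injective_iff_map_eq_zero θ).2 ?_, fun r ↦ ?_⟩⟩
  · rintro ⟨z, hz⟩ h0
    obtain ⟨x, rfl⟩ := NV.mkQ_surjective z
    obtain ⟨r, hr⟩ := (hmem x).1 hz
    rw [hθ, hr, MstScalar_tmul_one] at h0
    rw [h0, zero_tmul] at hr
    rw [Submodule.mk_eq_zero, Submodule.mkQ_apply, Submodule.Quotient.mk_eq_zero, hker]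
    exact hr
  · obtain ⟨x, hx⟩ := h.exists_prod_c_eq L hnodup (r ⊗ₜ 1) fun i _ ↦ MstAct_tmul_one _ _
    refine ⟨⟨NV.mkQ x, (hmem x).2 ⟨r, hx⟩⟩, ?_⟩
    rw [hθ]
    exact (congrArg _ hx).trans (MstScalar_tmul_one r)
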